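/- A non-alternating prestrategy σ on an arena A → B is a strategy (i.e., additionally receptive and courteous) if and only if composing with copycat on both sides leaves it unchanged: cc_B ⊙ σ ⊙ cc_A = σ. -/

import Mathlib

set_option autoImplicit false

/-- Immediate causality `a ⋗ b` for a relation `le`. -/
def immOf {α : Type} (le : α → α → Prop) (a b : α) : Prop :=
  le a b ∧ a ≠ b ∧ ∀ c, le a c → le c b → c = a ∨ c = b

/-- Configurations: finite, down-closed, consistent sets. -/
def ConfigOf {α : Type} (le conflict : α → α → Prop) (x : Set α) : Prop :=
  x.Finite ∧ (∀ e ∈ x, ∀ e', le e' e → e' ∈ x) ∧ ∀ e ∈ x, ∀ e' ∈ x, ¬ conflict e e'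

/-- Minimality for a causal dependency relation. -/
def MinimalOf {α : Type} (le : α → α → Prop) (a : α) : Prop := ∀ a', le a' a → a' = a

/-- An arena: an event structure with polarities (`true` = Player `+`,
`false` = Opponent `−`) which is alternating, forestial and race-free. -/
structure Arena (α : Type) where
  le : α → α → Prop
  conflict : α → α → Prop
  pol : α → Bool
  le_refl : ∀ e, le e e
  le_trans : ∀ {a b c : α}, le a b → le b c → le a c
  le_antisymm : ∀ {a b : α}, le a b → le b a → a = b
  finite_causes : ∀ e : α, Set.Finite {e' | le e' e}
  conflict_irrefl : ∀ e, ¬ conflict e e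
  conflict_symm : ∀ {a b : α}, conflict a b → conflict b a
  conflict_inherit : ∀ {a b b' : α}, conflict a b → le b b' → conflict a b'
  alternating : ∀ {a b : α}, immOf le a b → pol a ≠ pol b
  forestial : ∀ {a1 a2 a : α}, le a1 a → le a2 a → le a1 a2 ∨ le a2 a1
  race_free : ∀ {a1 a2 : α}, conflict a1 a2 →
    (∀ a1' a2', le a1' a1 → le a2' a2 → conflict a1' a2' → a1' = a1 ∧ a2' = a2) →
    pol a1 = pol a2

/-- Events of the arrow arena `A ⊸ B`: `inl b` for a move of `B`, and
`inr (b, a)` for a move of the copy of `A^⊥` sitting under the minimal move `b`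
of `B`. -/
abbrev ArrEv (α β : Type) : Type := β ⊕ (β × α)

/-- Polarity on `A ⊸ B` (the `A` side is dualized). -/
def arrPol {α β : Type} (A : Arena α) (B : Arena β) : ArrEv α β → Bool
  | Sum.inl b => B.pol b
  | Sum.inr ba => ! A.pol ba.2

/-- Causal dependency on `A ⊸ B`: each copy of `A^⊥` depends on the corresponding
minimal move of `B`. -/
def arrLE {α β : Type} (A : Arena α) (B : Arena β) : ArrEv α β → ArrEv α β → Prop
  | Sum.inl b, Sum.inl b' => B.le b b'
  | Sum.inl b, Sum.inr ba => b = ba.1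
  | Sum.inr ba, Sum.inr ba' => ba.1 = ba'.1 ∧ A.le ba.2 ba'.2
  | Sum.inr _, Sum.inl _ => False

/-- Configurations of `A ⊸ B` (following the characterisation of the arrow
conflict): finite, down-closed sets with well-formed tags, componentwise
consistent, whose projection to `A^⊥ ∥ B` is injective. -/
def ArrConfig {α β : Type} (A : Arena α) (B : Arena β) (x : Set (ArrEv α β)) : Prop :=
  x.Finite ∧
  (∀ e ∈ x, ∀ e', arrLE A B e' e → e' ∈ x) ∧
  (∀ (b : β) (a : α), Sum.inr (b, a) ∈ x → MinimalOf B.le b) ∧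
  (∀ b b' : β, Sum.inl b ∈ x → Sum.inl b' ∈ x → ¬ B.conflict b b') ∧
  (∀ (b b' : β) (a a' : α), Sum.inr (b, a) ∈ x → Sum.inr (b', a') ∈ x →
      ¬ A.conflict a a') ∧
  (∀ (b b' : β) (a : α), Sum.inr (b, a) ∈ x → Sum.inr (b', a) ∈ x → b = b')

/-- A non-alternating play on `A ⊸ B`: pairwise-distinct events, every prefix a
configuration, negative start. -/
def ArrPlay {α β : Type} (A : Arena α) (B : Arena β) (s : List (ArrEv α β)) : Prop :=
  (∀ t, t <+: s → ArrConfig A B {e | e ∈ t}) ∧ s.Nodup ∧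
  (∀ e : ArrEv α β, s[0]? = some e → arrPol A B e = false)

/-- A non-alternating prestrategy on `A ⊸ B`: a non-empty prefix-closed set of
non-alternating plays. -/
def ArrPrestrat {α β : Type} (A : Arena α) (B : Arena β)
    (σ : Set (List (ArrEv α β))) : Prop :=
  ([] ∈ σ) ∧ (∀ s t : List (ArrEv α β), s <+: t → t ∈ σ → s ∈ σ) ∧
  (∀ s ∈ σ, ArrPlay A B s)

/-- Receptivity: closure under negative extensions that are valid plays. -/
def ArrReceptive {α β : Type} (A : Arena α) (B : Arena β)
    (σ : Set (List (ArrEv α β))) : Prop :=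
  ∀ s ∈ σ, ∀ e : ArrEv α β, arrPol A B e = false →
    ArrPlay A B (s ++ [e]) → s ++ [e] ∈ σ

/-- Courtesy: if `s·e·f·t ∈ σ` with `pol f = −` or `pol e = +`, and `s·f` is a
valid play, then `s·f·e·t ∈ σ`. -/
def ArrCourteous {α β : Type} (A : Arena α) (B : Arena β)
    (σ : Set (List (ArrEv α β))) : Prop :=
  ∀ (s t : List (ArrEv α β)) (e f : ArrEv α β),
    (s ++ e :: f :: t) ∈ σ → (arrPol A B f = false ∨ arrPol A B e = true) →
    ArrPlay A B (s ++ [f]) → (s ++ f :: e :: t) ∈ σ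

/-- Events of the interaction arena `(A ⊸ B) ⊸ C`: `[r, c]`, `[m, b]_c`, and
`[l, a]_{b,c}`. -/
abbrev IEv (α β γ : Type) : Type := γ ⊕ ((γ × β) ⊕ (γ × β × α))

/-- Causal dependency on `(A ⊸ B) ⊸ C`. -/
def iLE {α β γ : Type} (A : Arena α) (B : Arena β) (C : Arena γ) :
    IEv α β γ → IEv α β γ → Prop
  | Sum.inl c, Sum.inl c' => C.le c c'
  | Sum.inl c, Sum.inr (Sum.inl cb) => c = cb.1
  | Sum.inl c, Sum.inr (Sum.inr cba) => c = cba.1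
  | Sum.inr (Sum.inl cb), Sum.inr (Sum.inl cb') => cb.1 = cb'.1 ∧ B.le cb.2 cb'.2
  | Sum.inr (Sum.inl cb), Sum.inr (Sum.inr cba) => cb.1 = cba.1 ∧ cb.2 = cba.2.1
  | Sum.inr (Sum.inr cba), Sum.inr (Sum.inr cba') =>
      cba.1 = cba'.1 ∧ cba.2.1 = cba'.2.1 ∧ A.le cba.2.2 cba'.2.2
  | _, _ => False

/-- Configurations of `(A ⊸ B) ⊸ C`. -/
def IConfig {α β γ : Type} (A : Arena α) (B : Arena β) (C : Arena γ)
    (x : Set (IEv α β γ)) : Prop :=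
  x.Finite ∧
  (∀ e ∈ x, ∀ e', iLE A B C e' e → e' ∈ x) ∧
  (∀ (c : γ) (b : β), Sum.inr (Sum.inl (c, b)) ∈ x → MinimalOf C.le c) ∧
  (∀ (c : γ) (b : β) (a : α), Sum.inr (Sum.inr (c, b, a)) ∈ x →
      MinimalOf C.le c ∧ MinimalOf B.le b) ∧
  (∀ c c' : γ, Sum.inl c ∈ x → Sum.inl c' ∈ x → ¬ C.conflict c c') ∧
  (∀ (c c' : γ) (b b' : β), Sum.inr (Sum.inl (c, b)) ∈ x →
      Sum.inr (Sum.inl (c', b')) ∈ x → ¬ B.conflict b b') ∧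
  (∀ (c c' : γ) (b b' : β) (a a' : α), Sum.inr (Sum.inr (c, b, a)) ∈ x →
      Sum.inr (Sum.inr (c', b', a')) ∈ x → ¬ A.conflict a a') ∧
  (∀ (c c' : γ) (b : β), Sum.inr (Sum.inl (c, b)) ∈ x →
      Sum.inr (Sum.inl (c', b)) ∈ x → c = c') ∧
  (∀ (c c' : γ) (b b' : β) (a : α), Sum.inr (Sum.inr (c, b, a)) ∈ x →
      Sum.inr (Sum.inr (c', b', a)) ∈ x → c = c' ∧ b = b')

/-- Restriction of interaction events to `A ⊸ B`. -/
def restAB {α β γ : Type} : IEv α β γ → Option (ArrEv α β)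
  | Sum.inl _ => none
  | Sum.inr (Sum.inl cb) => some (Sum.inl cb.2)
  | Sum.inr (Sum.inr cba) => some (Sum.inr (cba.2.1, cba.2.2))

/-- Restriction of interaction events to `B ⊸ C`. -/
def restBC {α β γ : Type} : IEv α β γ → Option (ArrEv β γ)
  | Sum.inl c => some (Sum.inl c)
  | Sum.inr (Sum.inl cb) => some (Sum.inr cb)
  | Sum.inr (Sum.inr _) => none

/-- Restriction of interaction events to `A ⊸ C`. -/
def restAC {α β γ : Type} : IEv α β γ → Option (ArrEv α γ)
  | Sum.inl c => some (Sum.inl c)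
  | Sum.inr (Sum.inl _) => none
  | Sum.inr (Sum.inr cba) => some (Sum.inr (cba.1, cba.2.2))

/-- Composition `τ ⊙ σ` of sets of non-alternating plays by parallel interaction
plus hiding: the restrictions to `A ⊸ C` of the valid interaction sequences on
`(A ⊸ B) ⊸ C` whose restrictions to `A ⊸ B` and `B ⊸ C` belong to `σ` and `τ`. -/
def icomp {α β γ : Type} (A : Arena α) (B : Arena β) (C : Arena γ)
    (σ : Set (List (ArrEv α β))) (τ : Set (List (ArrEv β γ))) :
    Set (List (ArrEv α γ)) :=
  {s | ∃ u : List (IEv α β γ),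
        (∀ t, t <+: u → IConfig A B C {e | e ∈ t}) ∧ u.Nodup ∧
        u.filterMap restAB ∈ σ ∧ u.filterMap restBC ∈ τ ∧ s = u.filterMap restAC}

/-- The asynchronous copycat strategy on `A ⊸ A`: the balanced well-linked plays.
Every prefix reaches a position `x ∥ y` with `y ⊑ x` in the Scott order
(`y ⊇⁻ x ∩ y ⊆⁺ x`: left-only occurrences are positive in `A`, right-only ones
negative), and minimal left moves are justified by the equal right move. -/
def ccArr {α : Type} (A : Arena α) : Set (List (ArrEv α α)) :=
  {s | ArrPlay A A s ∧
    (∀ t, t <+: s →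
      (∀ a : α, (∃ b : α, Sum.inr (b, a) ∈ t) → Sum.inl a ∉ t → A.pol a = true) ∧
      (∀ a : α, Sum.inl a ∈ t → (∀ b : α, Sum.inr (b, a) ∉ t) → A.pol a = false)) ∧
    (∀ b a : α, Sum.inr (b, a) ∈ s → MinimalOf A.le a → b = a)}

section ListLemmas

variable {ι ε : Type}

theorem exists_prefix_of_prefix_filterMap {f : ι → Option ε} {u : List ι} {t : List ε}
    (h : t <+: u.filterMap f) : ∃ t', t' <+: u ∧ t = t'.filterMap f := by
  obtain ⟨r, hr⟩ := h
  obtain ⟨u₁, u₂, rfl, rfl, -⟩ := List.filterMap_eq_append_iff.1 hr.symm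
  exact ⟨u₁, List.prefix_append _ _, rfl⟩

theorem nodup_filterMap_of_injOn {f : ι → Option ε} {u : List ι} (hu : u.Nodup)
    (hf : ∀ x ∈ u, ∀ y ∈ u, ∀ e, f x = some e → f y = some e → x = y) :
    (u.filterMap f).Nodup := by
  induction u with
  | nil => simp
  | cons x u ih =>
    have ih' := ih hu.of_cons fun y hy z hz => hf y (by simp [hy]) z (by simp [hz])
    cases hx : f x with
    | none => simpa [List.filterMap_cons, hx] using ih'
    | some e =>
      simp only [List.filterMap_cons, hx, List.nodup_cons]
      refine ⟨fun he => ?_, ih'⟩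
      obtain ⟨y, hy, hye⟩ := List.mem_filterMap.1 he
      exact (List.nodup_cons.1 hu).1
        (hf x (by simp) y (by simp [hy]) e hx hye ▸ hy)

theorem nodup_of_nodup_filterMap {ε' : Type} {f : ι → Option ε} {g : ι → Option ε'} {u : List ι}
    (hf : (u.filterMap f).Nodup) (hg : (u.filterMap g).Nodup)
    (hfg : ∀ x, (∃ e, f x = some e) ∨ ∃ e, g x = some e) : u.Nodup := by
  rw [List.nodup_iff_sublist]
  intro x hx
  rcases hfg x with ⟨e, he⟩ | ⟨e, he⟩
  · exact List.nodup_iff_sublist.1 hf e (by simpa [he] using hx.filterMap f)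
  · exact List.nodup_iff_sublist.1 hg e (by simpa [he] using hx.filterMap g)

end ListLemmas

section Arena

variable {α : Type} (A : Arena α)

/-- The causal order of an arena. -/
abbrev Arena.partialOrder : PartialOrder α where
  le := A.le
  le_refl := A.le_refl
  le_trans _ _ _ := A.le_trans
  le_antisymm _ _ := A.le_antisymm

theorem Arena.exists_root (a : α) : ∃ r, MinimalOf A.le r ∧ A.le r a := by
  let _ := A.partialOrder
  obtain ⟨r, hr⟩ := (A.finite_causes a).exists_minimal ⟨a, A.le_refl a⟩
  exact ⟨r, fun r' h => A.le_antisymm h (hr.2 (A.le_trans h hr.1) h), hr.1⟩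

/-- The minimal event below a given event. -/
noncomputable def Arena.root (a : α) : α := (A.exists_root a).choose

theorem Arena.root_minimal (a : α) : MinimalOf A.le (A.root a) := (A.exists_root a).choose_spec.1

theorem Arena.root_le (a : α) : A.le (A.root a) a := (A.exists_root a).choose_spec.2

variable {A}

theorem Arena.eq_of_minimal {r r' a : α} (hr : MinimalOf A.le r) (hr' : MinimalOf A.le r')
    (h : A.le r a) (h' : A.le r' a) : r = r' := by
  rcases A.forestial h h' with h | h
  · exact hr' _ h
  · exact (hr _ h).symm

theorem Arena.exists_minimal_conflict {a b : α} (h : A.conflict a b) :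
    ∃ a' b', A.le a' a ∧ A.le b' b ∧ A.conflict a' b' ∧ A.pol a' = A.pol b' := by
  let _ := A.partialOrder
  have hfin : {p : α × α | A.le p.1 a ∧ A.le p.2 b ∧ A.conflict p.1 p.2}.Finite :=
    ((A.finite_causes a).prod (A.finite_causes b)).subset fun p hp => ⟨hp.1, hp.2.1⟩
  obtain ⟨⟨a', b'⟩, ⟨ha, hb, hc⟩, hmin⟩ :=
    hfin.exists_minimal ⟨(a, b), A.le_refl a, A.le_refl b, h⟩
  refine ⟨a', b', ha, hb, hc, A.race_free hc fun a₁ b₁ h₁ h₂ h₃ => ?_⟩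
  have := hmin (y := (a₁, b₁)) ⟨A.le_trans h₁ ha, A.le_trans h₂ hb, h₃⟩ ⟨h₁, h₂⟩
  exact ⟨A.le_antisymm h₁ this.1, A.le_antisymm h₂ this.2⟩

end Arena

section Plays

variable {α β : Type} {A : Arena α} {B : Arena β}

theorem ArrConfig.of_subset {x y : Set (ArrEv α β)} (hx : ArrConfig A B x) (hyx : y ⊆ x)
    (hy : ∀ e ∈ y, ∀ e', arrLE A B e' e → e' ∈ y) : ArrConfig A B y := by
  obtain ⟨h₁, -, h₃, h₄, h₅, h₆⟩ := hx
  exact ⟨h₁.subset hyx, hy, fun b a h => h₃ b a (hyx h),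
    fun b b' h h' => h₄ b b' (hyx h) (hyx h'),
    fun b b' a a' h h' => h₅ b b' a a' (hyx h) (hyx h'),
    fun b b' a h h' => h₆ b b' a (hyx h) (hyx h')⟩

theorem ArrConfig.union (hnegA : ∀ a : α, MinimalOf A.le a → A.pol a = false)
    {x y : Set (ArrEv α β)} (hx : ArrConfig A B x) (hy : ArrConfig A B y)
    (hneg : ∀ e ∈ x, arrPol A B e = false → e ∈ y)
    (hpos : ∀ e ∈ y, arrPol A B e = true → e ∈ x) : ArrConfig A B (x ∪ y) := by
  obtain ⟨x₁, x₂, x₃, x₄, x₅, x₆⟩ := hx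
  obtain ⟨y₁, y₂, y₃, y₄, y₅, y₆⟩ := hy
  have hB : ∀ b b', Sum.inl b ∈ x → Sum.inl b' ∈ y → ¬ B.conflict b b' := by
    intro b b' hb hb' hc
    obtain ⟨c, c', hcb, hcb', hcc, hp⟩ := Arena.exists_minimal_conflict hc
    have hcx := x₂ _ hb (Sum.inl c) hcb
    have hcy := y₂ _ hb' (Sum.inl c') hcb'
    cases h : B.pol c with
    | false => exact y₄ _ _ (hneg _ hcx h) hcy hcc
    | true => exact x₄ _ _ hcx (hpos _ hcy (hp.symm.trans h)) hcc
  have hA : ∀ b b' a a', Sum.inr (b, a) ∈ x → Sum.inr (b', a') ∈ y → ¬ A.conflict a a' := by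
    intro b b' a a' ha ha' hc
    obtain ⟨c, c', hca, hca', hcc, hp⟩ := Arena.exists_minimal_conflict hc
    have hcx := x₂ _ ha (Sum.inr (b, c)) ⟨rfl, hca⟩
    have hcy := y₂ _ ha' (Sum.inr (b', c')) ⟨rfl, hca'⟩
    cases h : A.pol c with
    | false => exact x₅ _ _ _ _ hcx (hpos _ hcy (by simp [arrPol, ← hp, h])) hcc
    | true => exact y₅ _ _ _ _ (hneg _ hcx (by simp [arrPol, h])) hcy hcc
  have hI : ∀ b b' a, Sum.inr (b, a) ∈ x → Sum.inr (b', a) ∈ y → b = b' := by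
    intro b b' a ha ha'
    have hcx := x₂ _ ha (Sum.inr (b, A.root a)) ⟨rfl, A.root_le a⟩
    have hcy := y₂ _ ha' (Sum.inr (b', A.root a)) ⟨rfl, A.root_le a⟩
    exact x₆ _ _ _ hcx (hpos _ hcy (by simp [arrPol, hnegA _ (A.root_minimal a)]))
  refine ⟨x₁.union y₁, ?_, ?_, ?_, ?_, ?_⟩
  · rintro e (he | he) e' h
    · exact Or.inl (x₂ _ he _ h)
    · exact Or.inr (y₂ _ he _ h)
  · rintro b a (h | h)
    · exact x₃ _ _ h
    · exact y₃ _ _ h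
  · rintro b b' (h | h) (h' | h')
    · exact x₄ _ _ h h'
    · exact hB _ _ h h'
    · exact fun hc => hB _ _ h' h (B.conflict_symm hc)
    · exact y₄ _ _ h h'
  · rintro b b' a a' (h | h) (h' | h')
    · exact x₅ _ _ _ _ h h'
    · exact hA _ _ _ _ h h'
    · exact fun hc => hA _ _ _ _ h' h (A.conflict_symm hc)
    · exact y₅ _ _ _ _ h h'
  · rintro b b' a (h | h) (h' | h')
    · exact x₆ _ _ _ h h'
    · exact hI _ _ _ h h'
    · exact (hI _ _ _ h' h).symm
    · exact y₆ _ _ _ h h'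

theorem ArrPlay.config {s : List (ArrEv α β)} (h : ArrPlay A B s) : ArrConfig A B {e | e ∈ s} :=
  h.1 s (List.prefix_refl s)

theorem ArrPlay.of_prefix {s t : List (ArrEv α β)} (h : ArrPlay A B s) (hts : t <+: s) :
    ArrPlay A B t := by
  refine ⟨fun r hr => h.1 r (hr.trans hts), h.2.1.sublist hts.sublist, fun e he => h.2.2 e ?_⟩
  obtain ⟨r, rfl⟩ := hts
  cases t with
  | nil => simp at he
  | cons x t => simpa using he

theorem ArrPlay.of_configs (hnegB : ∀ b : β, MinimalOf B.le b → B.pol b = false)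
    {s : List (ArrEv α β)} (hc : ∀ t, t <+: s → ArrConfig A B {e | e ∈ t}) (hs : s.Nodup) :
    ArrPlay A B s := by
  refine ⟨hc, hs, fun e he => ?_⟩
  cases s with
  | nil => simp at he
  | cons x s =>
    obtain rfl : x = e := by simpa using he
    have hx := (hc [x] (by simp)).2.1 x (by simp)
    rcases x with b | ⟨b, a⟩
    · exact hnegB b fun b' hb' => by simpa using hx (Sum.inl b') hb'
    · simpa using hx (Sum.inl b) rfl

theorem ArrPlay.concat (hnegB : ∀ b : β, MinimalOf B.le b → B.pol b = false)
    {p v : List (ArrEv α β)} {e : ArrEv α β} {z : Set (ArrEv α β)} (hp : ArrPlay A B p)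
    (hv : ArrPlay A B (v ++ [e])) (hvp : v ⊆ p) (hep : e ∉ p) (hz : ArrConfig A B z)
    (hpz : ∀ x ∈ p, x ∈ z) (hez : e ∈ z) : ArrPlay A B (p ++ [e]) := by
  refine .of_configs hnegB (fun t ht => ?_) ?_
  · rcases List.prefix_concat_iff.1 ht with rfl | ht
    · refine hz.of_subset ?_ ?_
      · intro x hx
        rcases List.mem_append.1 hx with hx | hx
        · exact hpz x hx
        · rwa [List.mem_singleton.1 hx]
      · intro x hx y hy
        rcases List.mem_append.1 hx with hx | hx
        · exact List.mem_append_left _ (hp.config.2.1 x hx y hy)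
        · rw [List.mem_singleton.1 hx] at hy
          rcases List.mem_append.1 (hv.config.2.1 e (by simp) y hy) with h | h
          · exact List.mem_append_left _ (hvp h)
          · exact List.mem_append_right _ h
    · exact hp.1 t ht
  · rw [List.nodup_append]
    exact ⟨hp.2.1, by simp, by rintro x hx y hy rfl; simp_all⟩

theorem ArrPlay.swap (hnegB : ∀ b : β, MinimalOf B.le b → B.pol b = false)
    {s t : List (ArrEv α β)} {e f : ArrEv α β} (h : ArrPlay A B (s ++ e :: f :: t))
    (hf : ArrPlay A B (s ++ [f])) : ArrPlay A B (s ++ f :: e :: t) := by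
  have hperm : ∀ t' : List (ArrEv α β), (s ++ f :: e :: t').Perm (s ++ e :: f :: t') :=
    fun t' => (List.Perm.swap e f t').append_left s
  refine .of_configs hnegB (fun p hp => ?_) ((hperm t).nodup_iff.2 h.2.1)
  rw [show s ++ f :: e :: t = (s ++ [f]) ++ e :: t by simp] at hp
  rcases List.prefix_or_prefix_of_prefix hp (List.prefix_append _ _) with hp' | ⟨q, rfl⟩
  · exact hf.1 p hp'
  have hq := (List.prefix_append_right_inj _).1 hp
  rcases List.prefix_cons_iff.1 hq with rfl | ⟨t', rfl, ht'⟩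
  · simpa using hf.config
  · have := h.1 (s ++ e :: f :: t') (by simpa using ht')
    convert this using 3 with x
    simpa using (hperm t').mem_iff

end Plays

section Strategies

variable {α β : Type} {A : Arena α} {B : Arena β} {σ : Set (List (ArrEv α β))}

theorem ArrCourteous.move_to_front (hnegB : ∀ b : β, MinimalOf B.le b → B.pol b = false)
    (hplay : ∀ s ∈ σ, ArrPlay A B s) (hcour : ArrCourteous A B σ)
    {v r₁ r₂ : List (ArrEv α β)} {e : ArrEv α β} (h : v ++ (r₁ ++ e :: r₂) ∈ σ)
    (hpol : arrPol A B e = false ∨ ∀ x ∈ r₁, arrPol A B x = true)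
    (hv : ArrPlay A B (v ++ [e])) : v ++ e :: (r₁ ++ r₂) ∈ σ := by
  induction r₁ using List.reverseRecOn generalizing r₂ with
  | nil => simpa using h
  | append_singleton r₁ x ih =>
    have h' : (v ++ r₁) ++ x :: e :: r₂ ∈ σ := by simpa using h
    have hp := hplay _ h'
    have hmem : v ++ (r₁ ++ e :: (x :: r₂)) ∈ σ := by
      have := hcour _ _ _ _ h' (hpol.imp_right fun hx => hx x (by simp)) <|
        ArrPlay.concat hnegB (hp.of_prefix (List.prefix_append _ _)) hv (by simp) (fun he => by
          have := hp.2.1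
          rw [List.nodup_append] at this
          exact this.2.2 e he e (by simp) rfl)
          hp.config (fun x hx => List.mem_append_left _ hx) (by simp)
      simpa using this
    simpa using ih hmem (hpol.imp_right fun hx y hy => hx y (by simp [hy]))

/-- A strategy is closed under anticipating negative moves and delaying positive ones. -/
theorem mem_of_delay (hnegA : ∀ a : α, MinimalOf A.le a → A.pol a = false)
    (hnegB : ∀ b : β, MinimalOf B.le b → B.pol b = false) (hσ : ArrPrestrat A B σ)
    (hrec : ArrReceptive A B σ) (hcour : ArrCourteous A B σ) {s s' : List (ArrEv α β)}
    (hs : s ∈ σ) (hs' : ArrPlay A B s')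
    (hneg : ∀ e ∈ s, arrPol A B e = false → e ∈ s')
    (hpos : ∀ v e w, s' = v ++ e :: w → arrPol A B e = true →
      ∃ i, i <+: s ∧ e ∈ i ∧ ∀ f ∈ i, arrPol A B f = false → f ∈ v) : s' ∈ σ := by
  classical
  have hposmem : ∀ e ∈ s', arrPol A B e = true → e ∈ s := by
    intro e he hp
    obtain ⟨v, w, h⟩ := List.append_of_mem he
    obtain ⟨i, hi, hei, -⟩ := hpos v e w h hp
    exact hi.subset hei
  have hz := (hσ.2.2 s hs).config.union hnegA hs'.config hneg hposmem
  have key : ∀ v, v <+: s' → v ++ s.filter (fun x => x ∉ v) ∈ σ := by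
    intro v
    induction v using List.reverseRecOn with
    | nil => intro _; simpa using hs
    | append_singleton v e ih =>
      intro hve
      have hvs : v <+: s' := (List.prefix_append v [e]).trans hve
      have hv := ih hvs
      set r := s.filter (fun x => x ∉ v) with hr
      have hvplay := hs'.of_prefix hve
      have hplay := hσ.2.2 _ hv
      have hev : e ∉ v := by
        have := hvplay.2.1
        rw [List.nodup_append] at this
        exact fun h => this.2.2 e h e (by simp) rfl
      have hr' : s.filter (fun x => x ∉ v ++ [e]) = r.filter (fun x => x ≠ e) := by
        rw [hr, List.filter_filter]
        refine List.filter_congr fun x _ => ?_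
        simp [and_comm]
      rw [hr', List.append_assoc, List.singleton_append]
      have hsplit : ∀ r₁ r₂, r = r₁ ++ e :: r₂ → r.filter (fun x => x ≠ e) = r₁ ++ r₂ := by
        intro r₁ r₂ h
        have hnd : r.Nodup := (List.nodup_append.1 hplay.2.1).2.1
        rw [h, List.nodup_append, List.nodup_cons] at hnd
        have h₁ : r₁.filter (fun x => x ≠ e) = r₁ := List.filter_eq_self.2 fun x hx => by
          simpa using hnd.2.2 x hx e (by simp)
        have h₂ : r₂.filter (fun x => x ≠ e) = r₂ := List.filter_eq_self.2 fun x hx => by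
          have : x ≠ e := fun h => hnd.2.1.1 (h ▸ hx)
          simpa using this
        rw [h, List.filter_append, List.filter_cons, h₁, h₂]
        simp
      cases hp : arrPol A B e with
      | false =>
        by_cases her : e ∈ r
        · obtain ⟨r₁, r₂, h⟩ := List.append_of_mem her
          rw [hsplit r₁ r₂ h]
          exact hcour.move_to_front hnegB hσ.2.2 (h ▸ hv) (Or.inl hp) hvplay
        · have hrr : r.filter (fun x => x ≠ e) = r := List.filter_eq_self.2 fun x hx => by
            have : x ≠ e := fun h => her (h ▸ hx)
            simpa using this
          have hext := hrec _ hv e hp <| hplay.concat hnegB hvplay (by simp) (by simp [hev, her])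
            hz (fun x hx => by
              rcases List.mem_append.1 hx with hx | hx
              · exact Or.inr (hvs.subset hx)
              · exact Or.inl (List.mem_of_mem_filter hx))
            (Or.inr (hve.subset (by simp)))
          rw [hrr]
          simpa using hcour.move_to_front (r₂ := []) hnegB hσ.2.2 (by simpa using hext)
            (Or.inl hp) hvplay
      | true =>
        obtain ⟨w, hw⟩ := hve
        obtain ⟨i, ⟨j, hij⟩, hei, hi⟩ := hpos v e w (by simp [← hw]) hp
        have hrij : r = i.filter (fun x => x ∉ v) ++ j.filter (fun x => x ∉ v) := by
          rw [hr, ← hij, List.filter_append]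
        obtain ⟨r₁, r₂, h⟩ := List.append_of_mem
          (show e ∈ i.filter (fun x => x ∉ v) by simp [hei, hev])
        have hrs : r = r₁ ++ e :: (r₂ ++ j.filter (fun x => x ∉ v)) := by
          rw [hrij, h]; simp
        rw [hsplit _ _ hrs]
        refine hcour.move_to_front hnegB hσ.2.2 (hrs ▸ hv) (Or.inr fun x hx => ?_) hvplay
        have hxi : x ∈ i.filter (fun x => x ∉ v) := by rw [h]; simp [hx]
        rw [List.mem_filter] at hxi
        by_contra hxp
        exact absurd (hi x hxi.1 (by simpa using hxp)) (by simpa using hxi.2)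
  exact hσ.2.1 _ _ (List.prefix_append _ _) (key s' (List.prefix_refl s'))

end Strategies

section Synchronization

variable {ι ε : Type}

/-- The Scott order between the positions reached through two projections of a sequence: events
only in the first are positive, events only in the second are negative. -/
def ScottLinked (fi fo : ι → Option ε) (pol : ε → Bool) (t : List ι) : Prop :=
  ∀ e, (e ∈ t.filterMap fi → e ∉ t.filterMap fo → pol e = true) ∧
    (e ∈ t.filterMap fo → e ∉ t.filterMap fi → pol e = false)

/-- Every prefix is linked in the Scott order. -/
def WellLinked (fi fo : ι → Option ε) (pol : ε → Bool) (u : List ι) : Prop :=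
  ∀ t, t <+: u → ScottLinked fi fo pol t

variable {fi fo : ι → Option ε} {pol : ε → Bool}

theorem WellLinked.nil : WellLinked fi fo pol [] := by
  intro t ht
  simp [List.prefix_nil.1 ht, ScottLinked]

theorem WellLinked.concat {u : List ι} {z : ι} (hu : WellLinked fi fo pol u)
    (hi : ∀ e, fi z = some e → fo z = some e ∨ pol e = true ∨ e ∈ u.filterMap fo)
    (ho : ∀ e, fo z = some e → fi z = some e ∨ pol e = false ∨ e ∈ u.filterMap fi) :
    WellLinked fi fo pol (u ++ [z]) := by
  intro t ht
  rcases List.prefix_concat_iff.1 ht with rfl | ht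
  · intro e
    have h := hu u (List.prefix_refl u) e
    have hi := hi e
    have ho := ho e
    have hmem : ∀ f : ι → Option ε,
        e ∈ (u ++ [z]).filterMap f ↔ e ∈ u.filterMap f ∨ f z = some e := by
      intro f
      simp only [List.mem_filterMap, List.mem_append, List.mem_singleton]
      constructor
      · rintro ⟨x, hx | rfl, h⟩
        · exact Or.inl ⟨x, hx, h⟩
        · exact Or.inr h
      · rintro (⟨x, hx, h⟩ | h)
        · exact ⟨x, Or.inl hx, h⟩
        · exact ⟨z, Or.inr rfl, h⟩
    rw [hmem, hmem]
    tauto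
  · exact hu t ht

/-- A way of transmitting events between two projections: copied events are played once on each
side, the others are played synchronously. -/
structure Copier (fi fo : ι → Option ε) where
  copied : ε → Prop
  inner : ε → ι
  outer : ε → ι
  both : ε → ι
  fi_inner : ∀ e, copied e → fi (inner e) = some e
  fo_inner : ∀ e, copied e → fo (inner e) = none
  fi_outer : ∀ e, copied e → fi (outer e) = none
  fo_outer : ∀ e, copied e → fo (outer e) = some e
  fi_both : ∀ e, ¬ copied e → fi (both e) = some e
  fo_both : ∀ e, ¬ copied e → fo (both e) = some e

namespace Copier

variable (K : Copier fi fo)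

open Classical in
/-- The full transmission of an event: negative events go inwards, positive ones outwards. -/
noncomputable def transmit (pol : ε → Bool) (e : ε) : List ι :=
  if K.copied e then
    if pol e = true then [K.inner e, K.outer e] else [K.outer e, K.inner e]
  else [K.both e]

theorem filterMap_fi_transmit (e : ε) : (K.transmit pol e).filterMap fi = [e] := by
  unfold transmit
  split_ifs with h h'
  · simp [K.fi_inner e h, K.fi_outer e h]
  · simp [K.fi_inner e h, K.fi_outer e h]
  · simp [K.fi_both e h]

theorem filterMap_fo_transmit (e : ε) : (K.transmit pol e).filterMap fo = [e] := by
  unfold transmit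
  split_ifs with h h'
  · simp [K.fo_inner e h, K.fo_outer e h]
  · simp [K.fo_inner e h, K.fo_outer e h]
  · simp [K.fo_both e h]

theorem filterMap_fi_flatMap (s : List ε) :
    (s.flatMap (K.transmit pol)).filterMap fi = s := by
  induction s with
  | nil => simp
  | cons e s ih => simp [List.flatMap_cons, ih, K.filterMap_fi_transmit]

theorem filterMap_fo_flatMap (s : List ε) :
    (s.flatMap (K.transmit pol)).filterMap fo = s := by
  induction s with
  | nil => simp
  | cons e s ih => simp [List.flatMap_cons, ih, K.filterMap_fo_transmit]

variable {K}

theorem wellLinked_append_inner {u : List ι} {e : ε} (hu : WellLinked fi fo pol u)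
    (he : K.copied e) (h : pol e = true ∨ e ∈ u.filterMap fo) :
    WellLinked fi fo pol (u ++ [K.inner e]) :=
  hu.concat (fun e' he' => by
      obtain rfl : e = e' := by simpa [K.fi_inner e he] using he'
      exact Or.inr h)
    (fun e' he' => by simp [K.fo_inner e he] at he')

theorem wellLinked_append_outer {u : List ι} {e : ε} (hu : WellLinked fi fo pol u)
    (he : K.copied e) (h : pol e = false ∨ e ∈ u.filterMap fi) :
    WellLinked fi fo pol (u ++ [K.outer e]) :=
  hu.concat (fun e' he' => by simp [K.fi_outer e he] at he')
    (fun e' he' => by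
      obtain rfl : e = e' := by simpa [K.fo_outer e he] using he'
      exact Or.inr h)

theorem wellLinked_append_transmit {u : List ι} (hu : WellLinked fi fo pol u) (e : ε) :
    WellLinked fi fo pol (u ++ K.transmit pol e) := by
  unfold transmit
  split_ifs with h h'
  · simpa using wellLinked_append_outer (wellLinked_append_inner hu h (Or.inl h')) h
      (Or.inr (by simp [K.fi_inner e h]))
  · simpa using wellLinked_append_inner
      (wellLinked_append_outer hu h (Or.inl (by simpa using h'))) h
      (Or.inr (by simp [K.fo_outer e h]))
  · exact hu.concat (fun e' he' => Or.inl (by rw [K.fo_both e h, ← he', K.fi_both e h]))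
      (fun e' he' => Or.inl (by rw [K.fi_both e h, ← he', K.fo_both e h]))

theorem wellLinked_append_flatMap {u : List ι} (hu : WellLinked fi fo pol u) (s : List ε) :
    WellLinked fi fo pol (u ++ s.flatMap (K.transmit pol)) := by
  induction s generalizing u with
  | nil => simpa using hu
  | cons e s ih => simpa [List.flatMap_cons] using ih (wellLinked_append_transmit hu e)

/-- Every event of a sequence is used by the copier. -/
def Uses (K : Copier fi fo) (u : List ι) : Prop :=
  ∀ z ∈ u, ∃ e, z = K.inner e ∨ z = K.outer e ∨ z = K.both e

theorem uses_transmit (e : ε) : K.Uses (K.transmit pol e) := by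
  intro z hz
  refine ⟨e, ?_⟩
  unfold transmit at hz
  split_ifs at hz <;> simp at hz <;> tauto

theorem uses_flatMap (s : List ε) : K.Uses (s.flatMap (K.transmit pol)) := by
  intro z hz
  obtain ⟨e, -, he⟩ := List.mem_flatMap.1 hz
  exact uses_transmit e z he

theorem uses_append {u v : List ι} (hu : K.Uses u) (hv : K.Uses v) : K.Uses (u ++ v) :=
  fun z hz => (List.mem_append.1 hz).elim (hu z) (hv z)

theorem uses_inner (e : ε) : K.Uses [K.inner e] :=
  fun z hz => ⟨e, Or.inl (by simpa using hz)⟩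

theorem uses_outer (e : ε) : K.Uses [K.outer e] :=
  fun z hz => ⟨e, Or.inr (Or.inl (by simpa using hz))⟩

end Copier

end Synchronization

section Interactions

variable {α β γ : Type} {A : Arena α} {B : Arena β} {C : Arena γ}

theorem inl_mem_filterMap_restAB {t : List (IEv α β γ)} {b : β} :
    Sum.inl b ∈ t.filterMap restAB ↔ ∃ c, Sum.inr (Sum.inl (c, b)) ∈ t := by
  simp [List.mem_filterMap, restAB]

theorem inr_mem_filterMap_restAB {t : List (IEv α β γ)} {b : β} {a : α} :
    Sum.inr (b, a) ∈ t.filterMap restAB ↔ ∃ c, Sum.inr (Sum.inr (c, b, a)) ∈ t := by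
  simp [List.mem_filterMap, restAB]

theorem inl_mem_filterMap_restBC {t : List (IEv α β γ)} {c : γ} :
    Sum.inl c ∈ t.filterMap restBC ↔ Sum.inl c ∈ t := by
  simp [List.mem_filterMap, restBC]

theorem inr_mem_filterMap_restBC {t : List (IEv α β γ)} {c : γ} {b : β} :
    Sum.inr (c, b) ∈ t.filterMap restBC ↔ Sum.inr (Sum.inl (c, b)) ∈ t := by
  simp [List.mem_filterMap, restBC]

theorem inl_mem_filterMap_restAC {t : List (IEv α β γ)} {c : γ} :
    Sum.inl c ∈ t.filterMap restAC ↔ Sum.inl c ∈ t := by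
  simp [List.mem_filterMap, restAC]

theorem inr_mem_filterMap_restAC {t : List (IEv α β γ)} {c : γ} {a : α} :
    Sum.inr (c, a) ∈ t.filterMap restAC ↔ ∃ b, Sum.inr (Sum.inr (c, b, a)) ∈ t := by
  simp [List.mem_filterMap, restAC]

theorem IConfig.restAB {t : List (IEv α β γ)} (h : IConfig A B C {e | e ∈ t}) :
    ArrConfig A B {e | e ∈ t.filterMap restAB} := by
  obtain ⟨-, hd, -, h₄, -, h₆, h₇, -, h₉⟩ := h
  refine ⟨List.finite_toSet _, ?_, ?_, ?_, ?_, ?_⟩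
  · rintro (b | ⟨b, a⟩) he (b' | ⟨b', a'⟩) hle
    · obtain ⟨c, hc⟩ := inl_mem_filterMap_restAB.1 he
      exact inl_mem_filterMap_restAB.2 ⟨c, hd _ hc (Sum.inr (Sum.inl (c, b'))) ⟨rfl, hle⟩⟩
    · exact hle.elim
    · obtain ⟨c, hc⟩ := inr_mem_filterMap_restAB.1 he
      exact inl_mem_filterMap_restAB.2 ⟨c, hd _ hc (Sum.inr (Sum.inl (c, b'))) ⟨rfl, hle⟩⟩
    · obtain ⟨c, hc⟩ := inr_mem_filterMap_restAB.1 he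
      exact inr_mem_filterMap_restAB.2
        ⟨c, hd _ hc (Sum.inr (Sum.inr (c, b', a'))) ⟨rfl, hle.1, hle.2⟩⟩
  · intro b a he
    obtain ⟨c, hc⟩ := inr_mem_filterMap_restAB.1 he
    exact (h₄ _ _ _ hc).2
  · intro b b' he he'
    obtain ⟨c, hc⟩ := inl_mem_filterMap_restAB.1 he
    obtain ⟨c', hc'⟩ := inl_mem_filterMap_restAB.1 he'
    exact h₆ _ _ _ _ hc hc'
  · intro b b' a a' he he'
    obtain ⟨c, hc⟩ := inr_mem_filterMap_restAB.1 he
    obtain ⟨c', hc'⟩ := inr_mem_filterMap_restAB.1 he'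
    exact h₇ _ _ _ _ _ _ hc hc'
  · intro b b' a he he'
    obtain ⟨c, hc⟩ := inr_mem_filterMap_restAB.1 he
    obtain ⟨c', hc'⟩ := inr_mem_filterMap_restAB.1 he'
    exact (h₉ _ _ _ _ _ hc hc').2

theorem IConfig.restBC {t : List (IEv α β γ)} (h : IConfig A B C {e | e ∈ t}) :
    ArrConfig B C {e | e ∈ t.filterMap restBC} := by
  obtain ⟨-, hd, h₃, -, h₅, h₆, -, h₈, -⟩ := h
  refine ⟨List.finite_toSet _, ?_, ?_, ?_, ?_, ?_⟩
  · rintro (c | ⟨c, b⟩) he (c' | ⟨c', b'⟩) hle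
    · rw [Set.mem_ofPred, inl_mem_filterMap_restBC] at he ⊢
      exact hd _ he (Sum.inl c') hle
    · exact hle.elim
    · rw [Set.mem_ofPred, inr_mem_filterMap_restBC] at he
      rw [Set.mem_ofPred, inl_mem_filterMap_restBC]
      exact hd _ he (Sum.inl c') hle
    · rw [Set.mem_ofPred, inr_mem_filterMap_restBC] at he ⊢
      exact hd _ he (Sum.inr (Sum.inl (c', b'))) hle
  · exact fun c b he => h₃ _ _ (inr_mem_filterMap_restBC.1 he)
  · exact fun c c' he he' =>
      h₅ _ _ (inl_mem_filterMap_restBC.1 he) (inl_mem_filterMap_restBC.1 he')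
  · exact fun c c' b b' he he' =>
      h₆ _ _ _ _ (inr_mem_filterMap_restBC.1 he) (inr_mem_filterMap_restBC.1 he')
  · exact fun c c' b he he' =>
      h₈ _ _ _ (inr_mem_filterMap_restBC.1 he) (inr_mem_filterMap_restBC.1 he')

theorem IConfig.restAC {t : List (IEv α β γ)} (h : IConfig A B C {e | e ∈ t}) :
    ArrConfig A C {e | e ∈ t.filterMap restAC} := by
  obtain ⟨-, hd, -, h₄, h₅, -, h₇, -, h₉⟩ := h
  refine ⟨List.finite_toSet _, ?_, ?_, ?_, ?_, ?_⟩
  · rintro (c | ⟨c, a⟩) he (c' | ⟨c', a'⟩) hle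
    · rw [Set.mem_ofPred, inl_mem_filterMap_restAC] at he ⊢
      exact hd _ he (Sum.inl c') hle
    · exact hle.elim
    · obtain ⟨b, hb⟩ := inr_mem_filterMap_restAC.1 he
      rw [Set.mem_ofPred, inl_mem_filterMap_restAC]
      exact hd _ hb (Sum.inl c') hle
    · obtain ⟨b, hb⟩ := inr_mem_filterMap_restAC.1 he
      exact inr_mem_filterMap_restAC.2
        ⟨b, hd _ hb (Sum.inr (Sum.inr (c', b, a'))) ⟨hle.1, rfl, hle.2⟩⟩
  · intro c a he
    obtain ⟨b, hb⟩ := inr_mem_filterMap_restAC.1 he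
    exact (h₄ _ _ _ hb).1
  · exact fun c c' he he' =>
      h₅ _ _ (inl_mem_filterMap_restAC.1 he) (inl_mem_filterMap_restAC.1 he')
  · intro c c' a a' he he'
    obtain ⟨b, hb⟩ := inr_mem_filterMap_restAC.1 he
    obtain ⟨b', hb'⟩ := inr_mem_filterMap_restAC.1 he'
    exact h₇ _ _ _ _ _ _ hb hb'
  · intro c c' a he he'
    obtain ⟨b, hb⟩ := inr_mem_filterMap_restAC.1 he
    obtain ⟨b', hb'⟩ := inr_mem_filterMap_restAC.1 he'
    exact (h₉ _ _ _ _ _ hb hb').1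

theorem ArrPlay.filterMap_restAB (hnegB : ∀ b : β, MinimalOf B.le b → B.pol b = false)
    {u : List (IEv α β γ)} (hc : ∀ t, t <+: u → IConfig A B C {e | e ∈ t}) (hu : u.Nodup) :
    ArrPlay A B (u.filterMap restAB) := by
  refine .of_configs hnegB (fun t ht => ?_) (nodup_filterMap_of_injOn hu ?_)
  · obtain ⟨t', ht', rfl⟩ := exists_prefix_of_prefix_filterMap ht
    exact (hc t' ht').restAB
  · obtain ⟨-, -, -, -, -, -, -, h₈, h₉⟩ := hc u (List.prefix_refl u)
    rintro (c | ⟨c, b⟩ | ⟨c, b, a⟩) hx (c' | ⟨c', b'⟩ | ⟨c', b', a'⟩) hy e h h' <;>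
      simp only [_root_.restAB, Option.some.injEq, reduceCtorEq] at h h' <;> subst h <;>
      simp only [Sum.inl.injEq, Sum.inr.injEq, Prod.mk.injEq, reduceCtorEq] at h'
    · obtain rfl := h'
      rw [h₈ _ _ _ hx hy]
    · obtain ⟨rfl, rfl⟩ := h'
      rw [(h₉ _ _ _ _ _ hx hy).1]

theorem ArrPlay.filterMap_restAC (hnegC : ∀ c : γ, MinimalOf C.le c → C.pol c = false)
    {u : List (IEv α β γ)} (hc : ∀ t, t <+: u → IConfig A B C {e | e ∈ t}) (hu : u.Nodup) :
    ArrPlay A C (u.filterMap restAC) := by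
  refine .of_configs hnegC (fun t ht => ?_) (nodup_filterMap_of_injOn hu ?_)
  · obtain ⟨t', ht', rfl⟩ := exists_prefix_of_prefix_filterMap ht
    exact (hc t' ht').restAC
  · obtain ⟨-, -, -, -, -, -, -, -, h₉⟩ := hc u (List.prefix_refl u)
    rintro (c | ⟨c, b⟩ | ⟨c, b, a⟩) hx (c' | ⟨c', b'⟩ | ⟨c', b', a'⟩) hy e h h' <;>
      simp only [_root_.restAC, Option.some.injEq, reduceCtorEq] at h h' <;> subst h <;>
      simp only [Sum.inl.injEq, Sum.inr.injEq, Prod.mk.injEq, reduceCtorEq] at h'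
    · rw [h']
    · obtain ⟨rfl, rfl⟩ := h'
      rw [(h₉ _ _ _ _ _ hx hy).2]

theorem ArrPlay.filterMap_restBC (hnegC : ∀ c : γ, MinimalOf C.le c → C.pol c = false)
    {u : List (IEv α β γ)} (hc : ∀ t, t <+: u → IConfig A B C {e | e ∈ t}) (hu : u.Nodup) :
    ArrPlay B C (u.filterMap restBC) := by
  refine .of_configs hnegC (fun t ht => ?_) (nodup_filterMap_of_injOn hu ?_)
  · obtain ⟨t', ht', rfl⟩ := exists_prefix_of_prefix_filterMap ht
    exact (hc t' ht').restBC
  · rintro (c | ⟨c, b⟩ | ⟨c, b, a⟩) hx (c' | ⟨c', b'⟩ | ⟨c', b', a'⟩) hy e h h' <;>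
      simp only [_root_.restBC, Option.some.injEq, reduceCtorEq] at h h' <;> subst h <;>
      simp only [Sum.inl.injEq, Sum.inr.injEq, Prod.mk.injEq, reduceCtorEq] at h'
    · rw [h']
    · rw [h'.1, h'.2]

theorem icomp_mono {σ σ' : Set (List (ArrEv α β))} {τ τ' : Set (List (ArrEv β γ))}
    (hσ : σ ⊆ σ') (hτ : τ ⊆ τ') : icomp A B C σ τ ⊆ icomp A B C σ' τ' := by
  rintro s ⟨u, hc, hu, h₁, h₂, hs⟩
  exact ⟨u, hc, hu, hσ h₁, hτ h₂, hs⟩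

theorem icomp_play (hnegC : ∀ c : γ, MinimalOf C.le c → C.pol c = false)
    {σ : Set (List (ArrEv α β))} {τ : Set (List (ArrEv β γ))} {s : List (ArrEv α γ)}
    (hs : s ∈ icomp A B C σ τ) : ArrPlay A C s := by
  obtain ⟨u, hc, hu, -, -, rfl⟩ := hs
  exact .filterMap_restAC hnegC hc hu

end Interactions

section Copycat

variable {α β ι : Type} {A : Arena α} {B : Arena β} {σ : Set (List (ArrEv α β))}

/-- A strategy contains the outer projection of every well-linked sequence whose inner projection
it contains. -/
theorem mem_of_wellLinked (hnegA : ∀ a : α, MinimalOf A.le a → A.pol a = false)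
    (hnegB : ∀ b : β, MinimalOf B.le b → B.pol b = false) (hσ : ArrPrestrat A B σ)
    (hrec : ArrReceptive A B σ) (hcour : ArrCourteous A B σ) {fi fo : ι → Option (ArrEv α β)}
    {u : List ι} (hu : WellLinked fi fo (arrPol A B) u) (hi : u.filterMap fi ∈ σ)
    (ho : ArrPlay A B (u.filterMap fo)) : u.filterMap fo ∈ σ := by
  refine mem_of_delay hnegA hnegB hσ hrec hcour hi ho (fun e he hp => ?_) fun v e w h hp => ?_
  · by_contra hne
    exact absurd ((hu u (List.prefix_refl u) e).1 he hne) (by simp [hp])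
  · rw [show v ++ e :: w = (v ++ [e]) ++ w by simp] at h
    obtain ⟨u₁, u₂, rfl, h₁, -⟩ := List.filterMap_eq_append_iff.1 h
    have hl := hu u₁ (List.prefix_append _ _)
    rw [ScottLinked, h₁] at hl
    refine ⟨u₁.filterMap fi, (List.prefix_append _ _).filterMap fi, ?_, fun f hf hfp => ?_⟩
    · by_contra hne
      exact absurd ((hl e).2 (by simp) hne) (by simp [hp])
    · by_contra hne
      have hfe : f ≠ e := by rintro rfl; simp [hp] at hfp
      exact absurd ((hl f).1 hf (by simp [hne, hfe])) (by simp [hfp])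

/-- Closure of `σ'` under the outer projections of the well-linked sequences used by a copier with
inner projection in `σ`. -/
def CopyClosed {fi fo : ι → Option (ArrEv α β)} (A : Arena α) (B : Arena β) (K : Copier fi fo)
    (σ σ' : Set (List (ArrEv α β))) : Prop :=
  ∀ u, WellLinked fi fo (arrPol A B) u → K.Uses u → u.filterMap fi ∈ σ →
    ArrPlay A B (u.filterMap fo) → u.filterMap fo ∈ σ'

namespace CopyClosed

variable {fi fo : ι → Option (ArrEv α β)} {K : Copier fi fo} {σ' : Set (List (ArrEv α β))}

theorem subset (h : CopyClosed A B K σ σ') (hσ : ∀ s ∈ σ, ArrPlay A B s) : σ ⊆ σ' := by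
  intro s hs
  have := h (s.flatMap (K.transmit (arrPol A B)))
    (by simpa using Copier.wellLinked_append_flatMap (K := K) WellLinked.nil s)
    (Copier.uses_flatMap s)
  rw [K.filterMap_fi_flatMap, K.filterMap_fo_flatMap] at this
  exact this hs (hσ s hs)

theorem receptive (h : CopyClosed A B K σ σ') {s : List (ArrEv α β)} {e : ArrEv α β}
    (hs : s ∈ σ) (he : K.copied e) (hp : arrPol A B e = false) (hse : ArrPlay A B (s ++ [e])) :
    s ++ [e] ∈ σ' := by
  have := h (s.flatMap (K.transmit (arrPol A B)) ++ [K.outer e])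
    (Copier.wellLinked_append_outer
      (by simpa using Copier.wellLinked_append_flatMap (K := K) WellLinked.nil s) he (Or.inl hp))
    (Copier.uses_append (Copier.uses_flatMap s) (Copier.uses_outer e))
  simp only [List.filterMap_append, K.filterMap_fi_flatMap, K.filterMap_fo_flatMap,
    List.filterMap_cons, List.filterMap_nil, K.fi_outer e he, K.fo_outer e he,
    List.append_nil] at this
  exact this hs hse

theorem courteous_neg (h : CopyClosed A B K σ σ') {s t : List (ArrEv α β)} {e f : ArrEv α β}
    (hs : s ++ e :: f :: t ∈ σ) (hf : K.copied f) (hp : arrPol A B f = false)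
    (hsw : ArrPlay A B (s ++ f :: e :: t)) : s ++ f :: e :: t ∈ σ' := by
  have := h (s.flatMap (K.transmit (arrPol A B)) ++ [K.outer f] ++ K.transmit (arrPol A B) e ++
      [K.inner f] ++ t.flatMap (K.transmit (arrPol A B)))
    (Copier.wellLinked_append_flatMap (Copier.wellLinked_append_inner
      (Copier.wellLinked_append_transmit (Copier.wellLinked_append_outer
        (by simpa using Copier.wellLinked_append_flatMap (K := K) WellLinked.nil s) hf
        (Or.inl hp)) e) hf (Or.inr (by simp [K.fo_outer f hf]))) t)
    (Copier.uses_append (Copier.uses_append (Copier.uses_append (Copier.uses_append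
      (Copier.uses_flatMap s) (Copier.uses_outer f)) (Copier.uses_transmit e))
      (Copier.uses_inner f)) (Copier.uses_flatMap t))
  simp only [List.filterMap_append, K.filterMap_fi_flatMap, K.filterMap_fo_flatMap,
    K.filterMap_fi_transmit, K.filterMap_fo_transmit,
    List.filterMap_cons, K.fi_outer f hf, K.fo_outer f hf, K.fi_inner f hf,
    K.fo_inner f hf, List.append_assoc, List.cons_append,
    List.nil_append] at this
  exact this hs hsw

theorem courteous_pos (h : CopyClosed A B K σ σ') {s t : List (ArrEv α β)} {e f : ArrEv α β}
    (hs : s ++ e :: f :: t ∈ σ) (he : K.copied e) (hp : arrPol A B e = true)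
    (hsw : ArrPlay A B (s ++ f :: e :: t)) : s ++ f :: e :: t ∈ σ' := by
  have := h (s.flatMap (K.transmit (arrPol A B)) ++ [K.inner e] ++ K.transmit (arrPol A B) f ++
      [K.outer e] ++ t.flatMap (K.transmit (arrPol A B)))
    (Copier.wellLinked_append_flatMap (Copier.wellLinked_append_outer
      (Copier.wellLinked_append_transmit (Copier.wellLinked_append_inner
        (by simpa using Copier.wellLinked_append_flatMap (K := K) WellLinked.nil s) he
        (Or.inl hp)) f) he (Or.inr (by simp [K.fi_inner e he]))) t)
    (Copier.uses_append (Copier.uses_append (Copier.uses_append (Copier.uses_append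
      (Copier.uses_flatMap s) (Copier.uses_inner e)) (Copier.uses_transmit f))
      (Copier.uses_outer e)) (Copier.uses_flatMap t))
  simp only [List.filterMap_append, K.filterMap_fi_flatMap, K.filterMap_fo_flatMap,
    K.filterMap_fi_transmit, K.filterMap_fo_transmit,
    List.filterMap_cons, K.fi_outer e he, K.fo_outer e he, K.fi_inner e he,
    K.fo_inner e he, List.append_assoc, List.cons_append,
    List.nil_append] at this
  exact this hs hsw

end CopyClosed

end Copycat

section LeftCopycat

variable {α β : Type} {A : Arena α} {B : Arena β}

/-- Transmission of the moves of `A` by copycat on `A`. -/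
noncomputable def leftCopier (A : Arena α) (β : Type) :
    Copier (restBC : IEv α α β → Option (ArrEv α β)) restAC where
  copied e := e.isRight
  inner := Sum.elim Sum.inl fun p => Sum.inr (Sum.inl p)
  outer := Sum.elim Sum.inl fun p => Sum.inr (Sum.inr (p.1, A.root p.2, p.2))
  both := Sum.elim Sum.inl fun p => Sum.inr (Sum.inl p)
  fi_inner := by rintro (b | ⟨b, a⟩) <;> simp [restBC]
  fo_inner := by rintro (b | ⟨b, a⟩) <;> simp [restAC]
  fi_outer := by rintro (b | ⟨b, a⟩) <;> simp [restBC]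
  fo_outer := by rintro (b | ⟨b, a⟩) <;> simp [restAC]
  fi_both := by rintro (b | ⟨b, a⟩) <;> simp [restBC]
  fo_both := by rintro (b | ⟨b, a⟩) <;> simp [restAC]

theorem leftCopier_tag {u : List (IEv α α β)} (hu : (leftCopier A β).Uses u) {b : β} {r a : α}
    (h : Sum.inr (Sum.inr (b, r, a)) ∈ u) : r = A.root a := by
  obtain ⟨b' | ⟨b', a'⟩, h⟩ := hu _ h <;>
  · simp [leftCopier] at h
    try exact h.2.1.trans (by rw [h.2.2])

theorem wellLinked_of_mem_ccArr_left {u : List (IEv α α β)} (hc : ∀ t, t <+: u → IConfig A A B {e | e ∈ t})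
    (hcc : u.filterMap restAB ∈ ccArr A) : WellLinked restBC restAC (arrPol A B) u := by
  intro t ht
  obtain ⟨-, hscott, htag⟩ := hcc
  obtain ⟨-, hd, -, -, -, -, -, h₈, -⟩ := hc t ht
  have hsc := hscott (t.filterMap restAB) (ht.filterMap restAB)
  have hlink : ∀ b b' r a, Sum.inr (Sum.inr (b, r, a)) ∈ t → Sum.inr (Sum.inl (b', a)) ∈ t →
      b = b' := by
    intro b b' r a hl hm
    have hl' := hd _ hl (Sum.inr (Sum.inr (b, r, A.root a))) ⟨rfl, rfl, A.root_le a⟩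
    have hr : r = A.root a := htag r _
      (inr_mem_filterMap_restAB.2 ⟨b, ht.subset hl'⟩) (A.root_minimal a)
    have hlr := hd _ hl (Sum.inr (Sum.inl (b, r))) ⟨rfl, rfl⟩
    have hmr := hd _ hm (Sum.inr (Sum.inl (b', r))) ⟨rfl, hr ▸ A.root_le a⟩
    exact h₈ _ _ _ hlr hmr
  rintro (b | ⟨b, a⟩)
  · rw [inl_mem_filterMap_restBC, inl_mem_filterMap_restAC]
    exact ⟨fun h h' => (h' h).elim, fun h h' => (h' h).elim⟩
  · rw [inr_mem_filterMap_restBC, inr_mem_filterMap_restAC]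
    refine ⟨fun hm hl => ?_, fun hl hm => ?_⟩
    · have := hsc.2 a (inl_mem_filterMap_restAB.2 ⟨b, hm⟩) fun r hr => by
        obtain ⟨b', hr⟩ := inr_mem_filterMap_restAB.1 hr
        exact hl ⟨r, hlink _ _ _ _ hr hm ▸ hr⟩
      simp [arrPol, this]
    · obtain ⟨r, hr⟩ := hl
      have := hsc.1 a ⟨r, inr_mem_filterMap_restAB.2 ⟨b, hr⟩⟩ fun h => by
        obtain ⟨b', hb'⟩ := inl_mem_filterMap_restAB.1 h
        exact hm (hlink _ _ _ _ hr hb' ▸ hb')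
      simp [arrPol, this]

theorem iconfig_left (hnegA : ∀ a : α, MinimalOf A.le a → A.pol a = false)
    {t : List (IEv α α β)} (hi : ArrConfig A B {e | e ∈ t.filterMap restBC})
    (ho : ArrConfig A B {e | e ∈ t.filterMap restAC})
    (hl : ScottLinked restBC restAC (arrPol A B) t) (hu : (leftCopier A β).Uses t) :
    IConfig A A B {e | e ∈ t} := by
  obtain ⟨-, i₂, i₃, i₄, i₅, i₆⟩ := hi
  obtain ⟨-, o₂, o₃, o₄, o₅, o₆⟩ := ho
  have root_root : ∀ a a', A.le a' a → A.root a' = A.root a := fun a a' h =>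
    Arena.eq_of_minimal (A.root_minimal a') (A.root_minimal a)
      (A.le_trans (A.root_le a') h) (A.root_le a)
  refine ⟨List.finite_toSet t, ?_, ?_, ?_, ?_, ?_, ?_, ?_, ?_⟩
  · rintro (b | ⟨b, a⟩ | ⟨b, r, a⟩) he (b' | ⟨b', a'⟩ | ⟨b', r', a'⟩) hle
    · exact inl_mem_filterMap_restBC.1
        (i₂ _ (inl_mem_filterMap_restBC.2 he) (Sum.inl b') hle)
    · exact hle.elim
    · exact hle.elim
    · exact inl_mem_filterMap_restBC.1
        (i₂ _ (inr_mem_filterMap_restBC.2 he) (Sum.inl b') hle)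
    · exact inr_mem_filterMap_restBC.1
        (i₂ _ (inr_mem_filterMap_restBC.2 he) (Sum.inr (b', a')) hle)
    · exact hle.elim
    · exact inl_mem_filterMap_restAC.1
        (o₂ _ (inr_mem_filterMap_restAC.2 ⟨r, he⟩) (Sum.inl b') hle)
    · obtain ⟨rfl, rfl⟩ : b' = b ∧ a' = r := hle
      have hr := leftCopier_tag hu he
      subst hr
      have hroot := o₂ _ (inr_mem_filterMap_restAC.2 ⟨_, he⟩) (Sum.inr (b', A.root a))
        ⟨rfl, A.root_le a⟩
      by_contra hne
      have := (hl _).2 hroot fun h => hne (inr_mem_filterMap_restBC.1 h)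
      simp [arrPol, hnegA _ (A.root_minimal a)] at this
    · obtain ⟨rfl, rfl, hle⟩ : b' = b ∧ r' = r ∧ A.le a' a := hle
      obtain ⟨r, hr⟩ := inr_mem_filterMap_restAC.1
        (o₂ _ (inr_mem_filterMap_restAC.2 ⟨_, he⟩) (Sum.inr (b', a')) ⟨rfl, hle⟩)
      have : r = r' := by
        rw [leftCopier_tag hu hr, leftCopier_tag hu he, root_root a a' hle]
      exact this ▸ hr
  · exact fun b a h => i₃ _ _ (inr_mem_filterMap_restBC.2 h)
  · exact fun b r a h => ⟨o₃ _ _ (inr_mem_filterMap_restAC.2 ⟨r, h⟩),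
      leftCopier_tag hu h ▸ A.root_minimal a⟩
  · exact fun b b' h h' =>
      i₄ _ _ (inl_mem_filterMap_restBC.2 h) (inl_mem_filterMap_restBC.2 h')
  · exact fun b b' a a' h h' =>
      i₅ _ _ _ _ (inr_mem_filterMap_restBC.2 h) (inr_mem_filterMap_restBC.2 h')
  · exact fun b b' r r' a a' h h' =>
      o₅ _ _ _ _ (inr_mem_filterMap_restAC.2 ⟨r, h⟩) (inr_mem_filterMap_restAC.2 ⟨r', h'⟩)
  · exact fun b b' a h h' =>
      i₆ _ _ _ (inr_mem_filterMap_restBC.2 h) (inr_mem_filterMap_restBC.2 h')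
  · exact fun b b' r r' a h h' =>
      ⟨o₆ _ _ _ (inr_mem_filterMap_restAC.2 ⟨r, h⟩) (inr_mem_filterMap_restAC.2 ⟨r', h'⟩),
        (leftCopier_tag hu h).trans (leftCopier_tag hu h').symm⟩

theorem copyClosed_left (hnegA : ∀ a : α, MinimalOf A.le a → A.pol a = false)
    {σ : Set (List (ArrEv α β))} (hσ : ∀ s ∈ σ, ArrPlay A B s) :
    CopyClosed A B (leftCopier A β) σ (icomp A A B (ccArr A) σ) := by
  intro u hl hu hi ho
  have hip := hσ _ hi
  have hc : ∀ t, t <+: u → IConfig A A B {e | e ∈ t} := fun t ht =>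
    iconfig_left hnegA (hip.1 _ (ht.filterMap restBC)) (ho.1 _ (ht.filterMap restAC)) (hl t ht)
      fun z hz => hu z (ht.subset hz)
  have hnd : u.Nodup := nodup_of_nodup_filterMap hip.2.1 ho.2.1 (by
    rintro (b | ⟨b, a⟩ | ⟨b, r, a⟩) <;> simp [restBC, restAC])
  refine ⟨u, hc, hnd, ⟨.filterMap_restAB hnegA hc hnd, fun t ht => ?_, fun r a h hmin => ?_⟩,
    hi, rfl⟩
  · obtain ⟨t, hut, rfl⟩ := exists_prefix_of_prefix_filterMap ht
    refine ⟨fun a h hne => ?_, fun a h hne => ?_⟩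
    · obtain ⟨r, hr⟩ := h
      obtain ⟨b, hb⟩ := inr_mem_filterMap_restAB.1 hr
      have := (hl t hut (Sum.inr (b, a))).2 (inr_mem_filterMap_restAC.2 ⟨r, hb⟩) fun h =>
        hne (inl_mem_filterMap_restAB.2 ⟨b, inr_mem_filterMap_restBC.1 h⟩)
      simpa [arrPol] using this
    · obtain ⟨b, hb⟩ := inl_mem_filterMap_restAB.1 h
      have := (hl t hut (Sum.inr (b, a))).1 (inr_mem_filterMap_restBC.2 hb) fun h => by
        obtain ⟨r, hr⟩ := inr_mem_filterMap_restAC.1 h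
        exact hne r (inr_mem_filterMap_restAB.2 ⟨b, hr⟩)
      simpa [arrPol] using this
  · obtain ⟨b, hb⟩ := inr_mem_filterMap_restAB.1 h
    exact (leftCopier_tag hu hb).trans (hmin _ (A.root_le a))

end LeftCopycat

section RightCopycat

variable {α β : Type} {A : Arena α} {B : Arena β}

/-- Transmission of the moves of `B` by copycat on `B`. -/
noncomputable def rightCopier (α : Type) (B : Arena β) :
    Copier (restAB : IEv α β β → Option (ArrEv α β)) restAC where
  copied e := e.isLeft
  inner := Sum.elim (fun b => Sum.inr (Sum.inl (B.root b, b)))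
    fun p => Sum.inr (Sum.inr (p.1, p.1, p.2))
  outer := Sum.elim Sum.inl fun p => Sum.inr (Sum.inr (p.1, p.1, p.2))
  both := Sum.elim Sum.inl fun p => Sum.inr (Sum.inr (p.1, p.1, p.2))
  fi_inner := by rintro (b | ⟨b, a⟩) <;> simp [restAB]
  fo_inner := by rintro (b | ⟨b, a⟩) <;> simp [restAC]
  fi_outer := by rintro (b | ⟨b, a⟩) <;> simp [restAB]
  fo_outer := by rintro (b | ⟨b, a⟩) <;> simp [restAC]
  fi_both := by rintro (b | ⟨b, a⟩) <;> simp [restAB]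
  fo_both := by rintro (b | ⟨b, a⟩) <;> simp [restAC]

theorem rightCopier_tag_middle {u : List (IEv α β β)} (hu : (rightCopier α B).Uses u) {c b : β}
    (h : Sum.inr (Sum.inl (c, b)) ∈ u) : c = B.root b := by
  obtain ⟨b' | ⟨b', a'⟩, h⟩ := hu _ h <;>
  · simp [rightCopier] at h
    try exact h.1.trans (by rw [h.2])

theorem rightCopier_tag_left {u : List (IEv α β β)} (hu : (rightCopier α B).Uses u) {c b : β}
    {a : α} (h : Sum.inr (Sum.inr (c, b, a)) ∈ u) : c = b := by
  obtain ⟨b' | ⟨b', a'⟩, h⟩ := hu _ h <;>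
  · simp [rightCopier] at h
    try exact h.1.trans h.2.1.symm

theorem wellLinked_of_mem_ccArr_right
    {u : List (IEv α β β)} (hc : ∀ t, t <+: u → IConfig A B B {e | e ∈ t})
    (hcc : u.filterMap restBC ∈ ccArr B) : WellLinked restAB restAC (arrPol A B) u := by
  intro t ht
  obtain ⟨-, hscott, htag⟩ := hcc
  obtain ⟨-, hd, -, h₄, -⟩ := hc t ht
  have hsc := hscott (t.filterMap restBC) (ht.filterMap restBC)
  have hlink : ∀ c b a, Sum.inr (Sum.inr (c, b, a)) ∈ t → c = b := by
    intro c b a h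
    have hm := hd _ h (Sum.inr (Sum.inl (c, b))) ⟨rfl, rfl⟩
    exact htag c b (inr_mem_filterMap_restBC.2 (ht.subset hm)) (h₄ _ _ _ h).2
  rintro (b | ⟨b, a⟩)
  · rw [inl_mem_filterMap_restAB, inl_mem_filterMap_restAC]
    refine ⟨fun hm ho => ?_, fun ho hm => ?_⟩
    · obtain ⟨c, hcb⟩ := hm
      exact hsc.1 b ⟨c, inr_mem_filterMap_restBC.2 hcb⟩ fun h =>
        ho (inl_mem_filterMap_restBC.1 h)
    · exact hsc.2 b (inl_mem_filterMap_restBC.2 ho) fun c h =>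
        hm ⟨c, inr_mem_filterMap_restBC.1 h⟩
  · rw [inr_mem_filterMap_restAB, inr_mem_filterMap_restAC]
    refine ⟨fun ⟨c, h⟩ h' => (h' ⟨b, ?_⟩).elim, fun ⟨c, h⟩ h' => (h' ⟨b, ?_⟩).elim⟩
    · exact hlink _ _ _ h ▸ h
    · obtain rfl := hlink _ _ _ h
      exact h

theorem iconfig_right (hnegB : ∀ b : β, MinimalOf B.le b → B.pol b = false)
    {t : List (IEv α β β)} (hi : ArrConfig A B {e | e ∈ t.filterMap restAB})
    (ho : ArrConfig A B {e | e ∈ t.filterMap restAC})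
    (hl : ScottLinked restAB restAC (arrPol A B) t) (hu : (rightCopier α B).Uses t) :
    IConfig A B B {e | e ∈ t} := by
  obtain ⟨-, i₂, i₃, i₄, i₅, i₆⟩ := hi
  obtain ⟨-, o₂, o₃, o₄, o₅, o₆⟩ := ho
  have root_root : ∀ b b', B.le b' b → B.root b' = B.root b := fun b b' h =>
    Arena.eq_of_minimal (B.root_minimal b') (B.root_minimal b)
      (B.le_trans (B.root_le b') h) (B.root_le b)
  refine ⟨List.finite_toSet t, ?_, ?_, ?_, ?_, ?_, ?_, ?_, ?_⟩
  · rintro (c | ⟨c, b⟩ | ⟨c, b, a⟩) he (c' | ⟨c', b'⟩ | ⟨c', b', a'⟩) hle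
    · exact inl_mem_filterMap_restAC.1
        (o₂ _ (inl_mem_filterMap_restAC.2 he) (Sum.inl c') hle)
    · exact hle.elim
    · exact hle.elim
    · obtain rfl : c' = c := hle
      obtain rfl := rightCopier_tag_middle hu he
      have hroot := i₂ _ (inl_mem_filterMap_restAB.2 ⟨_, he⟩) (Sum.inl (B.root b)) (B.root_le b)
      by_contra hne
      have := (hl _).1 hroot fun h => hne (inl_mem_filterMap_restAC.1 h)
      simp [arrPol, hnegB _ (B.root_minimal b)] at this
    · obtain ⟨rfl, hle⟩ : c' = c ∧ B.le b' b := hle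
      obtain ⟨c, hc⟩ := inl_mem_filterMap_restAB.1
        (i₂ _ (inl_mem_filterMap_restAB.2 ⟨_, he⟩) (Sum.inl b') hle)
      have : c = c' := by
        rw [rightCopier_tag_middle hu hc, rightCopier_tag_middle hu he, root_root b b' hle]
      exact this ▸ hc
    · exact hle.elim
    · exact inl_mem_filterMap_restAC.1
        (o₂ _ (inr_mem_filterMap_restAC.2 ⟨b, he⟩) (Sum.inl c') hle)
    · obtain ⟨rfl, rfl⟩ : c' = c ∧ b' = b := hle
      obtain rfl := rightCopier_tag_left hu he
      have hr := inr_mem_filterMap_restAB.2 ⟨_, he⟩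
      obtain ⟨c, hc⟩ := inl_mem_filterMap_restAB.1 (i₂ _ hr (Sum.inl c') rfl)
      have : c = c' := (rightCopier_tag_middle hu hc).trans (i₃ _ _ hr _ (B.root_le c'))
      exact this ▸ hc
    · obtain ⟨rfl, rfl, hle⟩ : c' = c ∧ b' = b ∧ A.le a' a := hle
      obtain ⟨c, hc⟩ := inr_mem_filterMap_restAB.1
        (i₂ _ (inr_mem_filterMap_restAB.2 ⟨_, he⟩) (Sum.inr (b', a')) ⟨rfl, hle⟩)
      have : c = c' := (rightCopier_tag_left hu hc).trans (rightCopier_tag_left hu he).symm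
      exact this ▸ hc
  · exact fun c b h => rightCopier_tag_middle hu h ▸ B.root_minimal b
  · exact fun c b a h => ⟨o₃ _ _ (inr_mem_filterMap_restAC.2 ⟨b, h⟩),
      i₃ _ _ (inr_mem_filterMap_restAB.2 ⟨c, h⟩)⟩
  · exact fun c c' h h' =>
      o₄ _ _ (inl_mem_filterMap_restAC.2 h) (inl_mem_filterMap_restAC.2 h')
  · exact fun c c' b b' h h' =>
      i₄ _ _ (inl_mem_filterMap_restAB.2 ⟨c, h⟩) (inl_mem_filterMap_restAB.2 ⟨c', h'⟩)
  · exact fun c c' b b' a a' h h' =>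
      i₅ _ _ _ _ (inr_mem_filterMap_restAB.2 ⟨c, h⟩) (inr_mem_filterMap_restAB.2 ⟨c', h'⟩)
  · exact fun c c' b h h' =>
      (rightCopier_tag_middle hu h).trans (rightCopier_tag_middle hu h').symm
  · exact fun c c' b b' a h h' =>
      ⟨o₆ _ _ _ (inr_mem_filterMap_restAC.2 ⟨b, h⟩) (inr_mem_filterMap_restAC.2 ⟨b', h'⟩),
        i₆ _ _ _ (inr_mem_filterMap_restAB.2 ⟨c, h⟩) (inr_mem_filterMap_restAB.2 ⟨c', h'⟩)⟩

theorem copyClosed_right (hnegB : ∀ b : β, MinimalOf B.le b → B.pol b = false)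
    {σ : Set (List (ArrEv α β))} (hσ : ∀ s ∈ σ, ArrPlay A B s) :
    CopyClosed A B (rightCopier α B) σ (icomp A B B σ (ccArr B)) := by
  intro u hl hu hi ho
  have hip := hσ _ hi
  have hc : ∀ t, t <+: u → IConfig A B B {e | e ∈ t} := fun t ht =>
    iconfig_right hnegB (hip.1 _ (ht.filterMap restAB)) (ho.1 _ (ht.filterMap restAC)) (hl t ht)
      fun z hz => hu z (ht.subset hz)
  have hnd : u.Nodup := nodup_of_nodup_filterMap hip.2.1 ho.2.1 (by
    rintro (b | ⟨b, a⟩ | ⟨b, r, a⟩) <;> simp [restAB, restAC])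
  refine ⟨u, hc, hnd, hi, ⟨.filterMap_restBC hnegB hc hnd, fun t ht => ?_, fun c b h hmin => ?_⟩,
    rfl⟩
  · obtain ⟨t, hut, rfl⟩ := exists_prefix_of_prefix_filterMap ht
    refine ⟨fun b ⟨c, h⟩ hne => (hl t hut (Sum.inl b)).1
      (inl_mem_filterMap_restAB.2 ⟨c, inr_mem_filterMap_restBC.1 h⟩) fun h =>
        hne (inl_mem_filterMap_restBC.2 (inl_mem_filterMap_restAC.1 h)),
      fun b h hne => (hl t hut (Sum.inl b)).2
        (inl_mem_filterMap_restAC.2 (inl_mem_filterMap_restBC.1 h)) fun h => ?_⟩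
    obtain ⟨c, hcb⟩ := inl_mem_filterMap_restAB.1 h
    exact hne c (inr_mem_filterMap_restBC.2 hcb)
  · exact (rightCopier_tag_middle hu (inr_mem_filterMap_restBC.1 h)).trans
      (hmin _ (B.root_le b))

end RightCopycat

section Invariance

variable {α β : Type} {A : Arena α} {B : Arena β} {σ : Set (List (ArrEv α β))}

theorem icomp_ccArr_left_subset (hnegA : ∀ a : α, MinimalOf A.le a → A.pol a = false)
    (hnegB : ∀ b : β, MinimalOf B.le b → B.pol b = false) (hσ : ArrPrestrat A B σ)
    (hrec : ArrReceptive A B σ) (hcour : ArrCourteous A B σ) :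
    icomp A A B (ccArr A) σ ⊆ σ := by
  rintro _ ⟨u, hc, hu, hcc, hs, rfl⟩
  exact mem_of_wellLinked hnegA hnegB hσ hrec hcour (wellLinked_of_mem_ccArr_left hc hcc) hs
    (.filterMap_restAC hnegB hc hu)

theorem icomp_ccArr_right_subset (hnegA : ∀ a : α, MinimalOf A.le a → A.pol a = false)
    (hnegB : ∀ b : β, MinimalOf B.le b → B.pol b = false) (hσ : ArrPrestrat A B σ)
    (hrec : ArrReceptive A B σ) (hcour : ArrCourteous A B σ) :
    icomp A B B σ (ccArr B) ⊆ σ := by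
  rintro _ ⟨u, hc, hu, hs, hcc, rfl⟩
  exact mem_of_wellLinked hnegA hnegB hσ hrec hcour (wellLinked_of_mem_ccArr_right hc hcc) hs
    (.filterMap_restAC hnegB hc hu)

theorem receptive_of_icomp_subset (hnegA : ∀ a : α, MinimalOf A.le a → A.pol a = false)
    (hnegB : ∀ b : β, MinimalOf B.le b → B.pol b = false) (hσ : ∀ s ∈ σ, ArrPlay A B s)
    (hl : icomp A A B (ccArr A) σ ⊆ σ) (hr : icomp A B B σ (ccArr B) ⊆ σ) :
    ArrReceptive A B σ := by
  rintro s hs (b | ⟨b, a⟩) hp hse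
  · exact hr ((copyClosed_right hnegB hσ).receptive hs rfl hp hse)
  · exact hl ((copyClosed_left hnegA hσ).receptive hs rfl hp hse)

theorem courteous_of_icomp_subset (hnegA : ∀ a : α, MinimalOf A.le a → A.pol a = false)
    (hnegB : ∀ b : β, MinimalOf B.le b → B.pol b = false) (hσ : ∀ s ∈ σ, ArrPlay A B s)
    (hl : icomp A A B (ccArr A) σ ⊆ σ) (hr : icomp A B B σ (ccArr B) ⊆ σ) :
    ArrCourteous A B σ := by
  rintro s t e f hs hp hsf
  have hsw := (hσ _ hs).swap hnegB hsf
  rcases hp with hp | hp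
  · rcases f with b | ⟨b, a⟩
    · exact hr ((copyClosed_right hnegB hσ).courteous_neg hs rfl hp hsw)
    · exact hl ((copyClosed_left hnegA hσ).courteous_neg hs rfl hp hsw)
  · rcases e with b | ⟨b, a⟩
    · exact hr ((copyClosed_right hnegB hσ).courteous_pos hs rfl hp hsw)
    · exact hl ((copyClosed_left hnegA hσ).courteous_pos hs rfl hp hsw)

end Invariance

/-- A non-alternating prestrategy `σ` on `A ⊸ B` (with `A`, `B` negative arenas)
is a strategy — i.e. additionally receptive and courteous — if and only if
composing with copycat on both sides leaves it unchanged: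
`cc_B ⊙ σ ⊙ cc_A = σ`. -/
theorem strategy_iff_copycat_invariant {α β : Type} (A : Arena α) (B : Arena β)
    (hnegA : ∀ a : α, MinimalOf A.le a → A.pol a = false)
    (hnegB : ∀ b : β, MinimalOf B.le b → B.pol b = false)
    (σ : Set (List (ArrEv α β))) (hσ : ArrPrestrat A B σ) :
    (ArrReceptive A B σ ∧ ArrCourteous A B σ) ↔
      icomp A B B (icomp A A B (ccArr A) σ) (ccArr B) = σ := by
  have hleft := (copyClosed_left hnegA hσ.2.2).subset hσ.2.2
  have hright := (copyClosed_right hnegB hσ.2.2).subset hσ.2.2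
  constructor
  · rintro ⟨hrec, hcour⟩
    rw [(icomp_ccArr_left_subset hnegA hnegB hσ hrec hcour).antisymm hleft]
    exact (icomp_ccArr_right_subset hnegA hnegB hσ hrec hcour).antisymm hright
  · intro h
    have hplay : ∀ s ∈ icomp A A B (ccArr A) σ, ArrPlay A B s := fun s => icomp_play hnegB
    have hl : icomp A A B (ccArr A) σ ⊆ σ :=
      ((copyClosed_right hnegB hplay).subset hplay).trans h.subset
    have hr : icomp A B B σ (ccArr B) ⊆ σ := (icomp_mono hleft subset_rfl).trans h.subset
    exact ⟨receptive_of_icomp_subset hnegA hnegB hσ.2.2 hl hr,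
      courteous_of_icomp_subset hnegA hnegB hσ.2.2 hl hr⟩
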